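/- arXiv:1811.01235 — 2 statements merged into one kernel-verified Lean document; each statement's English description precedes it below -/
import Mathlib

section
/- Let (Λ, δ) be a population protocol and b1, b2 ∈ ℕ. Let x, o ∈ ℕ^Λ be configurations such that x ⟹_q o via a path q with no b2-bottleneck. Define Δ = { d ∈ Λ : o(d) ≤ b1 }, d = |Δ|, Γ = Λ ∖ Δ, o^Δ = o restricted to Δ and o^Γ = o restricted to Γ. Then there is a matrix C̃3 ∈ ℤ^{Γ×Δ} with every entry of absolute value strictly less than 2^{d+1} such that for all e^Δ ∈ ℕ^Δ: if b2 ≥ |Λ|·b1 + d·2^d·max(b1, e^Δ)·|Λ|², if x(s) ≥ b2 for all s ∈ Λ, and if o(s) ≥ b2 for all s ∈ Γ, then, letting p ∈ ℕ^Λ be defined by p(s) = d·2^{d+1}·max(b1, e^Δ) for all s ∈ Λ, one has p + x ⟹ p + o^Γ + C̃3·o^Δ − C̃3·e^Δ + e^Δ. -/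
/-! Basic definitions for (leaderless) population protocols:
configurations, transitions, paths, reachability, bottlenecks, stability. -/

namespace PP

variable {Λ : Type*}

open Classical in
/-- The configuration consisting of a single agent in state `s`. -/
noncomputable def single (s : Λ) : Λ → ℕ := fun t => if t = s then 1 else 0

/-- The configuration consisting of the two agents of the ordered pair `r`. -/
noncomputable def pairConf (r : Λ × Λ) : Λ → ℕ := single r.1 + single r.2

/-- The transition with input pair `r` is applicable to configuration `c`. -/
def Applicable (c : Λ → ℕ) (r : Λ × Λ) : Prop := pairConf r ≤ c

/-- The result of applying the transition with inputs `r` (and outputs `δ r`) to `c`. -/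
noncomputable def applyTx (δ : Λ × Λ → Λ × Λ) (r : Λ × Λ) (c : Λ → ℕ) : Λ → ℕ :=
  c - pairConf r + pairConf (δ r)

/-- `PathFrom δ c p c'`: executing the transition sequence `p` (each transition given
by its ordered pair of input states) from `c` is valid and ends in `c'`. -/
inductive PathFrom (δ : Λ × Λ → Λ × Λ) : (Λ → ℕ) → List (Λ × Λ) → (Λ → ℕ) → Prop
  | nil (c : Λ → ℕ) : PathFrom δ c [] c
  | cons {c c' : Λ → ℕ} (r : Λ × Λ) {p : List (Λ × Λ)} :
      Applicable c r → PathFrom δ (applyTx δ r c) p c' → PathFrom δ c (r :: p) c'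

/-- `Reach δ c c'` means `c ⟹ c'`: some finite path leads from `c` to `c'`. -/
def Reach (δ : Λ × Λ → Λ × Λ) (c c' : Λ → ℕ) : Prop := ∃ p, PathFrom δ c p c'

/-- `NoBottleneck δ b c p`: no transition of path `p` executed from `c` is a
`b`-bottleneck for the configuration to which it is applied. -/
inductive NoBottleneck (δ : Λ × Λ → Λ × Λ) (b : ℕ) : (Λ → ℕ) → List (Λ × Λ) → Prop
  | nil (c : Λ → ℕ) : NoBottleneck δ b c []
  | cons {c : Λ → ℕ} (r : Λ × Λ) {p : List (Λ × Λ)} :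
      ¬(c r.1 ≤ b ∧ c r.2 ≤ b) → NoBottleneck δ b (applyTx δ r c) p →
      NoBottleneck δ b c (r :: p)

/-- A configuration is stable w.r.t. output state `y` if the count of `y` can never
change again. -/
def Stable (δ : Λ × Λ → Λ × Λ) (y : Λ) (o : Λ → ℕ) : Prop :=
  ∀ o', Reach δ o o' → o' y = o y

/-- The transition function is symmetric. -/
def Symmetric (δ : Λ × Λ → Λ × Λ) : Prop :=
  ∀ r1 r2 : Λ, δ (r2, r1) = ((δ (r1, r2)).2, (δ (r1, r2)).1)

end PP

open Finset

namespace PPAux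
open PP

variable {Λ : Type*}

lemma path_add {δ : Λ × Λ → Λ × Λ} {c c' : Λ → ℕ} {q : List (Λ × Λ)}
    (h : PathFrom δ c q c') (w : Λ → ℕ) : PathFrom δ (c + w) q (c' + w) := by
  induction h with
  | nil c => exact PathFrom.nil _
  | cons r ha _ ih =>
    rename_i c c' p _
    refine PathFrom.cons r (fun t => le_trans (ha t) (Nat.le_add_right _ _)) ?_
    have : applyTx δ r (c + w) = applyTx δ r c + w := by
      funext t
      have hat : pairConf r t ≤ c t := ha t
      simp only [applyTx, Pi.add_apply, Pi.sub_apply]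
      omega
    rw [this]; exact ih

lemma path_append {δ : Λ × Λ → Λ × Λ} {c c' c'' : Λ → ℕ} {q q' : List (Λ × Λ)}
    (h : PathFrom δ c q c') (h' : PathFrom δ c' q' c'') : PathFrom δ c (q ++ q') c'' := by
  induction h with
  | nil c => exact h'
  | cons r ha _ ih => exact PathFrom.cons r ha (ih h')

lemma path_erase [DecidableEq Λ] {δ : Λ × Λ → Λ × Λ} {c c' : Λ → ℕ} {q : List (Λ × Λ)}
    (h : PathFrom δ c q c') (r : Λ × Λ) (hr : r ∈ q) :
    PathFrom δ (c + pairConf (δ r)) (q.erase r) (c' + pairConf r) := by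
  induction h with
  | nil c => simp at hr
  | cons r' ha hp ih =>
    rename_i c c' p
    by_cases hrr : r' = r
    · subst hrr
      rw [List.erase_cons_head]
      have := path_add hp (pairConf r')
      convert this using 1
      funext t
      have hat : pairConf r' t ≤ c t := ha t
      simp only [applyTx, Pi.add_apply, Pi.sub_apply]
      omega
    · have hr2 : r ∈ p := by
        rcases List.mem_cons.1 hr with h | h
        · exact absurd h.symm hrr
        · exact h
      rw [List.erase_cons_tail (by simpa using hrr)]
      refine PathFrom.cons r' (fun t => le_trans (ha t) (Nat.le_add_right _ _)) ?_
      have h3 := ih hr2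
      convert h3 using 1
      funext t
      have hat : pairConf r' t ≤ c t := ha t
      simp only [applyTx, Pi.add_apply, Pi.sub_apply]
      omega

lemma path_remove [DecidableEq Λ] {δ : Λ × Λ → Λ × Λ} (r : Λ × Λ) (k : ℕ) :
    ∀ {c c' : Λ → ℕ} {q : List (Λ × Λ)}, PathFrom δ c q c' → k ≤ q.count r →
    ∃ q', PathFrom δ (c + k • pairConf (δ r)) q' (c' + k • pairConf r) ∧
      ∀ r', r' ≠ r → q'.count r' = q.count r' := by
  induction k with
  | zero => intro c c' q h _; exact ⟨q, by simpa using h, fun _ _ => rfl⟩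
  | succ k ih =>
    intro c c' q h hk
    have hm : r ∈ q := List.count_pos_iff.1 (by omega)
    obtain ⟨q', h1, h2⟩ := ih (path_erase h r hm) (by rw [List.count_erase_self]; omega)
    refine ⟨q', ?_, fun r' hr' => ?_⟩
    · rw [succ_nsmul', succ_nsmul', ← add_assoc, ← add_assoc]; exact h1
    · rw [h2 r' hr', List.count_erase_of_ne hr']

lemma path_remove_all [DecidableEq Λ] {δ : Λ × Λ → Λ × Λ} (R : Finset (Λ × Λ)) (k : Λ × Λ → ℕ) :
    ∀ {c c' : Λ → ℕ} {q : List (Λ × Λ)}, PathFrom δ c q c' → (∀ r ∈ R, k r ≤ q.count r) →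
    ∃ q', PathFrom δ (c + ∑ r ∈ R, k r • pairConf (δ r)) q' (c' + ∑ r ∈ R, k r • pairConf r) := by
  induction R using Finset.induction_on with
  | empty => intro c c' q h _; exact ⟨q, by simpa using h⟩
  | insert a R ha ih =>
    intro c c' q h hk
    obtain ⟨q', h1, h2⟩ := path_remove a (k a) h (hk a (mem_insert_self _ _))
    obtain ⟨q'', h3⟩ := ih h1 (fun r hr => by
      rw [h2 r (fun h => ha (h ▸ hr))]; exact hk r (mem_insert_of_mem hr))
    refine ⟨q'', ?_⟩
    rw [sum_insert ha, sum_insert ha, ← add_assoc, ← add_assoc]; exact h3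

lemma path_one {δ : Λ × Λ → Λ × Λ} (r : Λ × Λ) (c : Λ → ℕ) :
    PathFrom δ (c + pairConf r) [r] (c + pairConf (δ r)) := by
  refine PathFrom.cons r (fun t => Nat.le_add_left _ _) ?_
  have : applyTx δ r (c + pairConf r) = c + pairConf (δ r) := by
    funext t
    simp only [applyTx, Pi.add_apply, Pi.sub_apply]
    omega
  rw [this]; exact PathFrom.nil _

lemma path_many {δ : Λ × Λ → Λ × Λ} (r : Λ × Λ) (k : ℕ) : ∀ (c : Λ → ℕ),
    Reach δ (c + k • pairConf r) (c + k • pairConf (δ r)) := by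
  induction k with
  | zero => intro c; simp only [zero_smul]; exact ⟨_, PathFrom.nil _⟩
  | succ k ih =>
    intro c
    obtain ⟨q1, h1⟩ := ih (c + pairConf r)
    have h2 := path_one (δ := δ) r (c + k • pairConf (δ r))
    refine ⟨q1 ++ [r], path_append (c' := c + pairConf r + k • pairConf (δ r)) ?_ ?_⟩
    · convert h1 using 1; rw [succ_nsmul', add_assoc]
    · convert h2 using 1
      · abel
      · rw [succ_nsmul, add_assoc]

lemma path_many_all [DecidableEq Λ] {δ : Λ × Λ → Λ × Λ} (R : Finset (Λ × Λ)) (k : Λ × Λ → ℕ) :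
    ∀ (c : Λ → ℕ),
    Reach δ (c + ∑ r ∈ R, k r • pairConf r) (c + ∑ r ∈ R, k r • pairConf (δ r)) := by
  induction R using Finset.induction_on with
  | empty => intro c; exact ⟨_, PathFrom.nil _⟩
  | insert a R ha ih =>
    intro c
    obtain ⟨q1, h1⟩ := ih (c + k a • pairConf a)
    obtain ⟨q2, h2⟩ := path_many (δ := δ) a (k a) (c + ∑ r ∈ R, k r • pairConf (δ r))
    refine ⟨q1 ++ q2, path_append (c' := c + k a • pairConf a + ∑ r ∈ R, k r • pairConf (δ r)) ?_ ?_⟩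
    · convert h1 using 1; rw [sum_insert ha, add_assoc]
    · convert h2 using 1
      · abel
      · rw [sum_insert ha]; abel

lemma single_le (s t : Λ) : single s t ≤ 1 := by unfold single; split_ifs <;> simp

lemma pair_le (r : Λ × Λ) (t : Λ) : pairConf r t ≤ 2 := by
  have h1 := single_le r.1 t
  have h2 := single_le r.2 t
  simp only [pairConf, Pi.add_apply]; omega

/-- effect of a transition -/
noncomputable def eta (δ : Λ × Λ → Λ × Λ) (r : Λ × Λ) : Λ → ℤ :=
  fun t => (pairConf (δ r) t : ℤ) - pairConf r t

lemma modify [Fintype Λ] [DecidableEq Λ] {δ : Λ × Λ → Λ × Λ} {x o : Λ → ℕ} {q : List (Λ × Λ)}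
    (h : PathFrom δ x q o) (k : Λ × Λ → ℤ) (hk : ∀ r, |k r| ≤ q.count r) (P : ℕ)
    (hP : 2 * ∑ r, |k r| ≤ P) :
    ∃ z : Λ → ℕ, (∀ s, (z s : ℤ) = P + o s + ∑ r, k r * eta δ r s) ∧
      Reach δ ((fun _ => P) + x) z := by
  set kp : Λ × Λ → ℕ := fun r => (k r).toNat
  set kn : Λ × Λ → ℕ := fun r => (-k r).toNat
  have hkk : ∀ r, k r = kp r - kn r := fun r => by simp only [kp, kn]; omega
  have hka : ∀ r, |k r| = kp r + kn r := fun r => by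
    simp only [kp, kn]; rcases abs_cases (k r) with h | h <;> omega
  obtain ⟨q1, h1⟩ := path_remove_all univ kn h (fun r _ => by
    have h1 := hk r
    have h2 := hka r
    omega)
  have hlow : ∀ s, (∑ r, kn r • pairConf (δ r)) s + (∑ r, kp r • pairConf r) s ≤ P := by
    intro s
    have : ∑ r, kn r • pairConf (δ r) s + ∑ r, kp r • pairConf r s ≤ 2 * ∑ r, (kp r + kn r) := by
      rw [← sum_add_distrib, mul_sum]
      refine sum_le_sum fun r _ => ?_
      have a := Nat.mul_le_mul_left (kn r) (pair_le (δ r) s)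
      have b := Nat.mul_le_mul_left (kp r) (pair_le r s)
      simp only [smul_eq_mul]; omega
    have h3 : ((2 * ∑ r, (kp r + kn r) : ℕ) : ℤ) ≤ P := by
      push_cast; simpa only [hka] using hP
    simp only [Finset.sum_apply, Pi.smul_apply]
    exact le_trans this (by exact_mod_cast h3)
  set w : Λ → ℕ := fun s => P - (∑ r, kn r • pairConf (δ r)) s - (∑ r, kp r • pairConf r) s with hw
  have h2 := path_add h1 (w + ∑ r, kp r • pairConf r)
  obtain ⟨q2, h3⟩ := path_many_all (δ := δ) univ kp (o + ∑ r, kn r • pairConf r + w)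
  rw [← add_assoc] at h2
  refine ⟨o + ∑ r, kn r • pairConf r + w + ∑ r, kp r • pairConf (δ r), ?_, q1 ++ q2, path_append (c' := o + ∑ r, kn r • pairConf r + (w + ∑ r, kp r • pairConf r)) ?_ ?_⟩
  · intro s
    have hs := hlow s
    have hws : w s + ((∑ r, kn r • pairConf (δ r)) s + (∑ r, kp r • pairConf r) s) = P := by
      simp only [hw]; omega
    have e1 : ∑ r, k r * eta δ r s = ∑ r, (kp r : ℤ) * pairConf (δ r) s - ∑ r, (kp r : ℤ) * pairConf r s
        - ∑ r, (kn r : ℤ) * pairConf (δ r) s + ∑ r, (kn r : ℤ) * pairConf r s := by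
      rw [← sum_sub_distrib, ← sum_sub_distrib, ← sum_add_distrib]
      refine sum_congr rfl fun r _ => ?_
      rw [hkk r, eta]; ring
    rw [e1, ← hws]
    simp only [Pi.add_apply, Finset.sum_apply, Pi.smul_apply, smul_eq_mul]
    push_cast; ring
  · convert h2 using 1
    funext s
    have hs := hlow s
    simp only [Pi.add_apply, hw]; omega
  · convert h3 using 1
    abel

/-- good transitions for S -/
def Good (δ : Λ × Λ → Λ × Λ) (S : Finset Λ) (r : Λ × Λ) : Prop :=
  ((r.1 ∈ S ∧ r.2 ∉ S) ∨ (r.1 ∉ S ∧ r.2 ∈ S)) ∧ (δ r).1 ∉ S ∧ (δ r).2 ∉ S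

lemma sum_single [DecidableEq Λ] (S : Finset Λ) (s : Λ) :
    ∑ t ∈ S, single s t = if s ∈ S then 1 else 0 := by
  unfold single
  by_cases h : s ∈ S
  · rw [if_pos h, sum_eq_single s]
    · simp
    · intro b _ hb; simp [hb]
    · intro h'; exact absurd h h'
  · rw [if_neg h]
    refine sum_eq_zero fun t ht => ?_
    rw [if_neg]; rintro rfl; exact h ht

lemma sum_apply_tx [DecidableEq Λ] (δ : Λ × Λ → Λ × Λ) (S : Finset Λ) (r : Λ × Λ) (c : Λ → ℕ)
    (ha : Applicable c r) :
    ∑ t ∈ S, applyTx δ r c t + ((if r.1 ∈ S then 1 else 0) + (if r.2 ∈ S then 1 else 0)) =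
    ∑ t ∈ S, c t + ((if (δ r).1 ∈ S then 1 else 0) + (if (δ r).2 ∈ S then 1 else 0)) := by
  rw [← sum_single, ← sum_single, ← sum_single, ← sum_single, ← sum_add_distrib,
    ← sum_add_distrib, ← sum_add_distrib, ← sum_add_distrib]
  refine sum_congr rfl fun t _ => ?_
  have := ha t
  simp only [applyTx, pairConf, Pi.add_apply, Pi.sub_apply] at *
  omega

open Classical in
lemma drop_bound [Fintype Λ] [DecidableEq Λ] {δ : Λ × Λ → Λ × Λ} {b : ℕ} (S : Finset Λ)
    {x o : Λ → ℕ} {q : List (Λ × Λ)} (h : PathFrom δ x q o) :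
    NoBottleneck δ b x q →
    min (∑ t ∈ S, x t) (b - 1) ≤ ∑ t ∈ S, o t + ∑ r ∈ univ.filter (Good δ S), q.count r := by
  induction h with
  | nil c => intro _; simp
  | cons r ha _ ih =>
    rename_i c c' p _
    intro hn
    cases hn with
    | cons _ hnb hn =>
    have ih := ih hn
    have hs := sum_apply_tx δ S r c ha
    have hc : ∑ r' ∈ univ.filter (Good δ S), (r :: p).count r' =
        ∑ r' ∈ univ.filter (Good δ S), p.count r' + if Good δ S r then 1 else 0 := by
      simp only [List.count_cons, sum_add_distrib, beq_iff_eq]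
      congr 1
      rw [sum_ite_eq]; simp
    rw [hc]
    by_cases hb : ∑ t ∈ S, c t ≤ b
    · have hle : ∀ t ∈ S, c t ≤ b := fun t ht =>
        le_trans (single_le_sum (f := c) (fun _ _ => Nat.zero_le _) ht) hb
      have hnot : ¬ (r.1 ∈ S ∧ r.2 ∈ S) := fun h => hnb ⟨hle _ h.1, hle _ h.2⟩
      by_cases h1 : r.1 ∈ S <;> by_cases h2 : r.2 ∈ S <;> by_cases h3 : (δ r).1 ∈ S <;>
        by_cases h4 : (δ r).2 ∈ S <;> simp [Good, h1, h2, h3, h4] at hs hnot ⊢ <;> omega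
    · have h1 : ((if r.1 ∈ S then 1 else 0) + (if r.2 ∈ S then 1 else 0)) ≤ 2 := by
        split_ifs <;> simp
      omega

lemma path_subsingleton [Subsingleton Λ] {δ : Λ × Λ → Λ × Λ} {x o : Λ → ℕ} {q : List (Λ × Λ)}
    (h : PathFrom δ x q o) : x = o := by
  induction h with
  | nil c => rfl
  | cons r ha _ ih =>
    rw [← ih]
    funext t
    have := ha t
    simp only [applyTx, Pi.add_apply, Pi.sub_apply, Subsingleton.elim (δ r) r] at *
    omega

lemma exists_good [Fintype Λ] [DecidableEq Λ] {δ : Λ × Λ → Λ × Λ} {b1 b2 N : ℕ} (S : Finset Λ)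
    (hS : S.Nonempty)
    {x o : Λ → ℕ} {q : List (Λ × Λ)} (h : PathFrom δ x q o) (hnb : NoBottleneck δ b2 x q)
    (hN : 1 ≤ N) (hb : Fintype.card Λ * b1 + N * Fintype.card Λ ^ 2 ≤ b2)
    (hx : ∀ s, b2 ≤ x s) (ho : ∀ s ∈ S, o s ≤ b1) :
    ∃ r, Good δ S r ∧ N ≤ q.count r := by
  classical
  obtain ⟨a, ha⟩ := hS
  have hn : 0 < Fintype.card Λ := Fintype.card_pos_iff.2 ⟨a⟩
  by_cases hn1 : Fintype.card Λ = 1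
  · have : Subsingleton Λ := Fintype.card_le_one_iff_subsingleton.1 hn1.le
    have h1 := path_subsingleton h
    have h2 := hx a
    have h3 := ho a ha
    rw [h1] at h2
    rw [hn1] at hb
    omega
  by_contra hcon
  push Not at hcon
  have hd := drop_bound S h hnb
  have hxS : b2 ≤ ∑ t ∈ S, x t := le_trans (hx a) (single_le_sum (f := x) (fun _ _ => Nat.zero_le _) ha)
  have hoS : ∑ t ∈ S, o t ≤ Fintype.card Λ * b1 := by
    refine le_trans (sum_le_card_nsmul S o b1 ho) ?_
    rw [smul_eq_mul]; exact Nat.mul_le_mul_right _ (card_le_univ S)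
  have hg : ∑ r ∈ univ.filter (Good δ S), q.count r ≤ Fintype.card Λ ^ 2 * (N - 1) := by
    refine le_trans (sum_le_card_nsmul _ _ (N - 1) (fun r hr => ?_)) ?_
    · have := hcon r (mem_filter.1 hr).2
      omega
    · rw [smul_eq_mul]; refine Nat.mul_le_mul_right _ (le_trans (card_le_univ _) ?_)
      rw [Fintype.card_prod, sq]
  obtain ⟨M, rfl⟩ : ∃ M, N = M + 1 := ⟨N - 1, by omega⟩
  have h4 : 4 ≤ Fintype.card Λ ^ 2 := by
    have : 2 ≤ Fintype.card Λ := by omega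
    nlinarith
  simp only [Nat.add_sub_cancel] at hg
  have hcomm : Fintype.card Λ ^ 2 * M + Fintype.card Λ ^ 2 = (M + 1) * Fintype.card Λ ^ 2 := by ring
  have : min (∑ t ∈ S, x t) (b2 - 1) = b2 - 1 := min_eq_right (by omega)
  omega

/-- bound on positive and negative parts -/
def Bd [Fintype Λ] (B : ℤ) (v : Λ → ℤ) : Prop := ∑ t, max (v t) 0 ≤ B ∧ ∑ t, max (-v t) 0 ≤ B

lemma Bd.neg [Fintype Λ] {B : ℤ} {v : Λ → ℤ} (h : Bd B v) : Bd B (-v) := by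
  refine ⟨h.2, ?_⟩
  simpa using h.1

lemma Bd.abs_le [Fintype Λ] {B : ℤ} {v : Λ → ℤ} (h : Bd B v) (a : Λ) : |v a| ≤ B := by
  have h1 := single_le_sum (f := fun t => max (v t) 0) (fun _ _ => le_max_right _ _) (mem_univ a)
  have h2 := single_le_sum (f := fun t => max (-v t) 0) (fun _ _ => le_max_right _ _) (mem_univ a)
  have := h.1
  have := h.2
  rw [_root_.abs_le]
  constructor <;> grind

lemma Bd.step_nonneg [Fintype Λ] [DecidableEq Λ] {B : ℤ} {v : Λ → ℤ} (h : Bd B v) (a s c c' : Λ)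
    (hs : s ≠ a) (hc : c ≠ a) (hc' : c' ≠ a) (hv : 0 ≤ v a) :
    Bd (2 * B) (fun t => v t + v a * ((single c t : ℤ) + single c' t - single a t - single s t)) := by
  have hk := h.abs_le a
  rw [abs_of_nonneg hv] at hk
  have ss : ∀ u : Λ, ∑ t, v a * (single u t : ℤ) = v a := fun u => by
    rw [← mul_sum]
    have := sum_single univ u
    rw [if_pos (mem_univ u)] at this
    have h2 : ∑ t, (single u t : ℤ) = 1 := by exact_mod_cast this
    rw [h2, mul_one]
  have h1 := h.1
  have h2 := h.2
  have key : ∀ u t : Λ, (t = u ∧ single u t = 1) ∨ (t ≠ u ∧ single u t = 0) := fun u t => by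
    unfold single; by_cases h : t = u <;> simp [h]
  constructor
  · have : ∑ t, max (v t + v a * ((single c t : ℤ) + single c' t - single a t - single s t)) 0 ≤
      ∑ t, (max (v t) 0 + v a * single c t + v a * single c' t - v a * single a t) := by
      refine sum_le_sum fun t _ => ?_
      rcases key c t with ⟨e1, f1⟩ | ⟨e1, f1⟩ <;> rcases key c' t with ⟨e2, f2⟩ | ⟨e2, f2⟩ <;>
      rcases key a t with ⟨e3, f3⟩ | ⟨e3, f3⟩ <;> rcases key s t with ⟨e4, f4⟩ | ⟨e4, f4⟩ <;>
      rw [f1, f2, f3, f4] <;> push_cast <;> first | (exfalso; grind) | (try subst e3); grind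
    rw [sum_sub_distrib, sum_add_distrib, sum_add_distrib, ss, ss, ss] at this
    dsimp only
    omega
  · have : ∑ t, max (-(v t + v a * ((single c t : ℤ) + single c' t - single a t - single s t))) 0 ≤
      ∑ t, (max (-v t) 0 + v a * single s t) := by
      refine sum_le_sum fun t _ => ?_
      rcases key c t with ⟨e1, f1⟩ | ⟨e1, f1⟩ <;> rcases key c' t with ⟨e2, f2⟩ | ⟨e2, f2⟩ <;>
      rcases key a t with ⟨e3, f3⟩ | ⟨e3, f3⟩ <;> rcases key s t with ⟨e4, f4⟩ | ⟨e4, f4⟩ <;>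
      rw [f1, f2, f3, f4] <;> push_cast <;> first | (exfalso; grind) | (try subst e3); grind
    rw [sum_add_distrib, ss] at this
    dsimp only
    omega

lemma Bd.step [Fintype Λ] [DecidableEq Λ] {B : ℤ} {v : Λ → ℤ} (h : Bd B v) (a s c c' : Λ)
    (hs : s ≠ a) (hc : c ≠ a) (hc' : c' ≠ a) :
    Bd (2 * B) (fun t => v t + v a * ((single c t : ℤ) + single c' t - single a t - single s t)) := by
  rcases le_total 0 (v a) with hv | hv
  · exact h.step_nonneg a s c c' hs hc hc' hv
  · have := (h.neg.step_nonneg a s c c' hs hc hc' (by simpa using hv)).neg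
    convert this using 1
    funext t
    simp only [Pi.neg_apply]; ring

lemma good_eta [DecidableEq Λ] {δ : Λ × Λ → Λ × Λ} {S : Finset Λ} {r : Λ × Λ} (h : Good δ S r) :
    ∃ a s c c', a ∈ S ∧ s ∉ S ∧ c ∉ S ∧ c' ∉ S ∧
      eta δ r = fun t => (single c t : ℤ) + single c' t - single a t - single s t := by
  obtain ⟨h1 | h1, h2, h3⟩ := h
  · refine ⟨r.1, r.2, (δ r).1, (δ r).2, h1.1, h1.2, h2, h3, ?_⟩
    funext t; simp only [eta, pairConf, Pi.add_apply]; push_cast; ring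
  · refine ⟨r.2, r.1, (δ r).1, (δ r).2, h1.2, h1.1, h2, h3, ?_⟩
    funext t; simp only [eta, pairConf, Pi.add_apply]; push_cast; ring

lemma elim [Fintype Λ] [DecidableEq Λ] (δ : Λ × Λ → Λ × Λ) (G : Λ × Λ → Prop) (n : ℕ) :
    ∀ S : Finset Λ, S.card = n →
    (∀ S', S' ⊆ S → S'.Nonempty → ∃ r, Good δ S' r ∧ G r) →
    ∃ K : (Λ → ℤ) →ₗ[ℤ] (Λ × Λ → ℤ), ∀ v,
      (∀ r, K v r ≠ 0 → G r) ∧ (∀ s ∈ S, v s + ∑ r, K v r * eta δ r s = 0) ∧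
      ∀ B, Bd B v → ∑ r, |K v r| ≤ (2 ^ n - 1) * B ∧
        Bd (2 ^ n * B) (fun s => v s + ∑ r, K v r * eta δ r s) := by
  induction n with
  | zero =>
    intro S hS _
    refine ⟨0, fun v => ⟨by simp, ?_, ?_⟩⟩
    · rw [card_eq_zero.1 hS]; simp
    · intro B hB; simpa using hB
  | succ n ih =>
    intro S hS hG
    obtain ⟨r, hr, hGr⟩ := hG S (Subset.refl _) (card_pos.1 (by omega))
    obtain ⟨a, s, c, c', ha, hs, hc, hc', he⟩ := good_eta hr
    have hcard : (S.erase a).card = n := by rw [card_erase_of_mem ha]; omega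
    obtain ⟨K, hK⟩ := ih (S.erase a) hcard
      (fun S' h1 h2 => hG S' (h1.trans (erase_subset _ _)) h2)
    let T : (Λ → ℤ) →ₗ[ℤ] ℤ :=
      LinearMap.proj a + ∑ r', (eta δ r' a) • ((LinearMap.proj r').comp K)
    have hT : ∀ v, T v = v a + ∑ r', K v r' * eta δ r' a := fun v => by
      simp [T, mul_comm]
    let K' : (Λ → ℤ) →ₗ[ℤ] (Λ × Λ → ℤ) := K + (LinearMap.single ℤ (fun _ => ℤ) r).comp T
    have hK' : ∀ v r', K' v r' = K v r' + if r' = r then T v else 0 := fun v r' => by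
      simp only [K', LinearMap.add_apply, Pi.add_apply, LinearMap.comp_apply,
        LinearMap.single_apply, Pi.single_apply]
    have hsum : ∀ v t, v t + ∑ r', K' v r' * eta δ r' t =
        (v t + ∑ r', K v r' * eta δ r' t) + T v * eta δ r t := by
      intro v t
      simp only [hK', add_mul, sum_add_distrib, ite_mul, zero_mul, sum_ite_eq', mem_univ, if_true]
      ring
    have hsne : ∀ u, u ∉ S → u ≠ a := fun u hu h => hu (h ▸ ha)
    refine ⟨K', fun v => ⟨?_, ?_, ?_⟩⟩
    · intro r' h
      by_cases hrr : r' = r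
      · rw [hrr]; exact hGr
      · rw [hK', if_neg hrr, add_zero] at h
        exact (hK v).1 r' h
    · intro t ht
      rw [hsum]
      have hz : ∀ u, u ∉ S → (single u t : ℤ) = 0 := fun u hu => by
        unfold single; rw [if_neg]; · rfl
        · rintro rfl; exact hu ht
      have het : eta δ r t = - single a t := by
        rw [he]; simp only [hz s hs, hz c hc, hz c' hc']; ring
      rw [het]
      by_cases hta : t = a
      · subst hta
        rw [hT]; simp [single]
      · rw [(hK v).2.1 t (mem_erase.2 ⟨hta, ht⟩)]; simp [single, hta]
    · intro B hB
      obtain ⟨h1, h2⟩ := (hK v).2.2 B hB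
      have h3 := h2.abs_le a
      simp only [← hT] at h3
      constructor
      · calc ∑ r', |K' v r'| ≤ ∑ r', (|K v r'| + if r' = r then |T v| else 0) := by
              refine sum_le_sum fun r' _ => ?_
              rw [hK']
              refine (abs_add_le _ _).trans ?_
              split_ifs <;> simp
          _ = ∑ r', |K v r'| + |T v| := by
              rw [sum_add_distrib, sum_ite_eq']; simp
          _ ≤ (2 ^ (n + 1) - 1) * B := by rw [pow_succ]; linarith
      · have := h2.step a s c c' (hsne s hs) (hsne c hc) (hsne c' hc')
        rw [show (2 : ℤ) ^ (n + 1) * B = 2 * (2 ^ n * B) by ring]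
        convert this using 1
        funext t
        rw [hsum, he, hT]

end PPAux

/-- Lemma "produce-e": if `x ⟹_q o` via a path with no `b2`-bottleneck and
`Δ = { d | o(d) ≤ b1 }` (with `d = |Δ|`, `Γ = Λ ∖ Δ`), then there is a matrix
`C̃3 ∈ ℤ^{Γ×Δ}` with entries of absolute value `< 2^(d+1)` such that for all
`e^Δ ∈ ℕ^Δ`, provided `b2 ≥ |Λ|·b1 + d·2^d·max(b1, e^Δ)·|Λ|²`, `x(s) ≥ b2` for
all `s`, and `o(s) ≥ b2` for all `s ∈ Γ`, then, with
`p(s) = d·2^{d+1}·max(b1, e^Δ)` for every `s`,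
`p + x ⟹ p + o^Γ + C̃3·o^Δ − C̃3·e^Δ + e^Δ` (the target in particular lies in `ℕ^Λ`). -/
theorem stmt2 {Λ : Type*} [Fintype Λ] [DecidableEq Λ]
    (δ : Λ × Λ → Λ × Λ) (hsym : PP.Symmetric δ)
    (b1 b2 : ℕ) (x o : Λ → ℕ) (q : List (Λ × Λ))
    (hpath : PP.PathFrom δ x q o) (hnb : PP.NoBottleneck δ b2 x q)
    (Δ : Finset Λ) (hΔ : ∀ s : Λ, s ∈ Δ ↔ o s ≤ b1) :
    ∃ C3 : Λ → Λ → ℤ,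
      (∀ g d, C3 g d ≠ 0 → g ∉ Δ ∧ d ∈ Δ) ∧
      (∀ g d, |C3 g d| < 2 ^ (Δ.card + 1)) ∧
      ∀ eΔ : Λ → ℕ, (∀ s ∉ Δ, eΔ s = 0) →
        Fintype.card Λ * b1 +
            Δ.card * 2 ^ Δ.card * max b1 (Finset.univ.sup eΔ) * Fintype.card Λ ^ 2 ≤ b2 →
        (∀ s, b2 ≤ x s) → (∀ s ∉ Δ, b2 ≤ o s) →
        ∃ z : Λ → ℕ,
          (∀ s : Λ,
            (z s : ℤ) =
              (Δ.card * 2 ^ (Δ.card + 1) * max b1 (Finset.univ.sup eΔ) : ℕ) +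
                (if s ∈ Δ then 0 else (o s : ℤ)) +
                (∑ t ∈ Δ, C3 s t * (o t : ℤ)) - (∑ t ∈ Δ, C3 s t * (eΔ t : ℤ)) +
                (eΔ s : ℤ)) ∧
          PP.Reach δ
            ((fun _ => Δ.card * 2 ^ (Δ.card + 1) * max b1 (Finset.univ.sup eΔ)) + x) z := by
  classical
  set n := Fintype.card Λ with hn
  set N := (b2 - n * b1) / n ^ 2 with hNdef
  by_cases hH : (∀ s, b2 ≤ x s) ∧ 1 ≤ N
  · obtain ⟨hx, hN⟩ := hH
    have hNm : N * n ^ 2 ≤ b2 - n * b1 := Nat.div_mul_le_self _ _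
    have hn0 : 0 < n := by
      rcases Nat.eq_zero_or_pos n with h | h
      · rw [hNdef, h] at hN; simp at hN
      · exact h
    have hn2 : 0 < n ^ 2 := by positivity
    have hpos : 0 < N * n ^ 2 := Nat.mul_pos hN hn2
    have hb : n * b1 + N * n ^ 2 ≤ b2 := by omega
    obtain ⟨K, hK⟩ := PPAux.elim δ (fun r => N ≤ q.count r) Δ.card Δ rfl
      (fun S' h1 h2 => PPAux.exists_good S' h2 hpath hnb hN hb hx
        (fun s hs => (hΔ s).1 (h1 hs)))
    let T : (Λ → ℤ) → Λ → ℤ := fun v s => v s + ∑ r, K v r * PPAux.eta δ r s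
    have hB1 : ∀ t : Λ, PPAux.Bd 1 (Pi.single t (1 : ℤ)) := fun t => by
      constructor
      · rw [sum_eq_single t] <;> simp +contextual
      · rw [sum_eq_single t] <;> simp +contextual
    refine ⟨fun g t => if g ∉ Δ ∧ t ∈ Δ then T (Pi.single t 1) g else 0, ?_, ?_, ?_⟩
    · intro g t h
      by_contra hc
      exact h (if_neg hc)
    · intro g t
      have h2 : (2 : ℤ) ^ Δ.card < 2 ^ (Δ.card + 1) := by
        rw [pow_succ]; have : (0 : ℤ) < 2 ^ Δ.card := by positivity
        linarith
      dsimp only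
      split_ifs
      · have := ((hK (Pi.single t 1)).2.2 1 (hB1 t)).2.abs_le g
        rw [mul_one] at this
        exact lt_of_le_of_lt this h2
      · rw [abs_zero]; positivity
    · intro e he hbe _ _
      set M := max b1 (univ.sup e) with hM
      have hMN : Δ.card * 2 ^ Δ.card * M ≤ N := by
        rw [hNdef, Nat.le_div_iff_mul_le hn2]; omega
      let v : Λ → ℤ := fun s => if s ∈ Δ then (o s : ℤ) - e s else 0
      have hoM : ∀ s ∈ Δ, o s ≤ M := fun s hs => le_trans ((hΔ s).1 hs) (le_max_left _ _)
      have heM : ∀ s, e s ≤ M := fun s => le_trans (le_sup (mem_univ s)) (le_max_right _ _)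
      have hsumM : ∑ t : Λ, (if t ∈ Δ then (M : ℤ) else 0) = Δ.card * M := by
        rw [sum_ite_mem]; simp
      have hBv : PPAux.Bd (Δ.card * M : ℤ) v := by
        constructor
        · rw [← hsumM]
          refine sum_le_sum fun t _ => ?_
          by_cases ht : t ∈ Δ
          · have := hoM t ht
            simp only [v, ht, if_true]; omega
          · simp [v, ht]
        · rw [← hsumM]
          refine sum_le_sum fun t _ => ?_
          by_cases ht : t ∈ Δ
          · have := heM t
            simp only [v, ht, if_true]; omega
          · simp [v, ht]
      obtain ⟨hv1, hv2, hv3⟩ := hK v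
      obtain ⟨hs, -⟩ := hv3 _ hBv
      have hdM : (0 : ℤ) ≤ Δ.card * M := by positivity
      have hs2 : ∑ r, |K v r| ≤ 2 ^ Δ.card * (Δ.card * M : ℤ) := by nlinarith
      obtain ⟨z, hz, hreach⟩ := PPAux.modify hpath (K v) (fun r => by
        by_cases h0 : K v r = 0
        · rw [h0]; simp
        · have h1 := hv1 r h0
          have h2 := single_le_sum (f := fun r => |K v r|) (fun _ _ => abs_nonneg _) (mem_univ r)
          have h3 : ((Δ.card * 2 ^ Δ.card * M : ℕ) : ℤ) ≤ N := by exact_mod_cast hMN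
          have h4 : (N : ℤ) ≤ q.count r := by exact_mod_cast h1
          push_cast at h3
          linarith) (Δ.card * 2 ^ (Δ.card + 1) * M) (by
          push_cast; rw [pow_succ]; linarith)
      refine ⟨z, fun s => ?_, hreach⟩
      rw [hz s]
      have hes : ∑ t ∈ Δ, (if s ∉ Δ ∧ t ∈ Δ then T (Pi.single t 1) s else 0) * (o t : ℤ)
          - ∑ t ∈ Δ, (if s ∉ Δ ∧ t ∈ Δ then T (Pi.single t 1) s else 0) * (e t : ℤ)
          = if s ∈ Δ then 0 else T v s := by
        rw [← sum_sub_distrib]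
        by_cases hsΔ : s ∈ Δ
        · simp [hsΔ]
        · rw [if_neg hsΔ]
          let TL : (Λ → ℤ) →ₗ[ℤ] ℤ :=
            LinearMap.proj s + ∑ r', (PPAux.eta δ r' s) • ((LinearMap.proj r').comp K)
          have hT : ∀ v, T v s = TL v := fun v => by
            simp [T, TL, mul_comm]
          have hvs : v = ∑ t ∈ Δ, ((o t : ℤ) - e t) • (Pi.single t 1 : Λ → ℤ) := by
            funext u
            simp only [Finset.sum_apply, Pi.smul_apply, Pi.single_apply, smul_eq_mul, mul_ite,
              mul_one, mul_zero, sum_ite_eq, v]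
          rw [hT, hvs, map_sum]
          refine sum_congr rfl fun t ht => ?_
          rw [if_pos ⟨hsΔ, ht⟩, map_smul, hT, smul_eq_mul]; ring
      by_cases hsΔ : s ∈ Δ
      · have h5 := hv2 s hsΔ
        simp only [hsΔ, if_true, v] at hes h5 ⊢
        linarith
      · simp only [hsΔ, if_false, T] at hes ⊢
        have h6 : v s = 0 := if_neg hsΔ
        have h7 := he s hsΔ
        rw [h6] at hes
        rw [h7]
        push_cast
        linarith
  · refine ⟨fun _ _ => 0, by simp, by intro g t; simp, ?_⟩
    intro e he hbe hx _
    set M := max b1 (univ.sup e) with hM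
    have hN0 : N = 0 := by
      by_contra h
      exact hH ⟨hx, Nat.one_le_iff_ne_zero.2 h⟩
    have hdn : Δ.card ≤ n := card_le_univ Δ
    have hz : Δ.card = 0 ∨ M = 0 := by
      rcases Nat.eq_zero_or_pos n with h | h
      · left; omega
      · have : Δ.card * 2 ^ Δ.card * M ≤ N := by
          rw [hNdef, Nat.le_div_iff_mul_le (by positivity)]; omega
        rw [hN0] at this
        have h2 : Δ.card * 2 ^ Δ.card * M = 0 := by omega
        simpa using h2
    have hP : Δ.card * 2 ^ (Δ.card + 1) * M = 0 := by
      rcases hz with h | h <;> simp [h]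
    rw [hP]
    refine ⟨o, fun s => ?_, q, ?_⟩
    · have hd : s ∈ Δ → o s = 0 ∧ e s = 0 := fun hs => by
        rcases hz with h | h
        · rw [card_eq_zero.1 h] at hs; simp at hs
        · have h1 := (hΔ s).1 hs
          have h2 : b1 ≤ M := le_max_left _ _
          have h3 : e s ≤ M := le_trans (le_sup (mem_univ s)) (le_max_right _ _)
          omega
      by_cases hs : s ∈ Δ
      · simp [hs, hd hs]
      · simp [hs, he s hs]
    · convert hpath using 1
      funext s; simp
end

section
/- Let φ : ℕ^k → {0,1} be semilinear (i.e., φ⁻¹(1) is a semilinear subset of ℕ^k) and not eventually constant. Then there is α > 0 and an infinite subset D ⊆ D^k_α such that one of the following two conditions holds: (1) for all m ∈ D, φ(m) ≠ φ(2m); or (2) there is i ∈ {1,…,k} such that for all m ∈ D, φ(m) ≠ φ(m + u_i) and φ(m) ≠ φ(2(m + u_i)). -/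
open Finset

/-- `c ∈ ℕ^k` is `α`-dense: every strictly positive coordinate is at least `α‖c‖`,
where `‖c‖` is the sum of the coordinates. -/
def AlphaDense {k : ℕ} (α : ℝ) (c : Fin k → ℕ) : Prop :=
  ∀ i, 0 < c i → α * (∑ j, (c j : ℝ)) ≤ (c i : ℝ)

/-- A periodic coset in `ℕ^k`:
`{ b + n1·p1 + ⋯ + nl·pl : n1, …, nl ∈ ℕ }`. -/
def IsPeriodicCoset {k : ℕ} (P : Set (Fin k → ℕ)) : Prop :=
  ∃ (base : Fin k → ℕ) (l : ℕ) (per : Fin l → Fin k → ℕ),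
    P = {x | ∃ n : Fin l → ℕ, x = base + ∑ i, n i • per i}

/-- A set is semilinear if it is a finite union of periodic cosets. -/
def Semilinear {k : ℕ} (S : Set (Fin k → ℕ)) : Prop :=
  ∃ (m : ℕ) (P : Fin m → Set (Fin k → ℕ)),
    (∀ j, IsPeriodicCoset (P j)) ∧ S = ⋃ j, P j

/-- `φ` is almost constant on `D`: `φ⁻¹(0) ∩ D` or `φ⁻¹(1) ∩ D` is finite. -/
def AlmostConstantOn {k : ℕ} (φ : (Fin k → ℕ) → Bool) (D : Set (Fin k → ℕ)) : Prop :=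
  {m ∈ D | φ m = false}.Finite ∨ {m ∈ D | φ m = true}.Finite

/-- `φ` is eventually constant: constant on `ℕ^k_{≥m0}` for some `m0`. -/
def EventuallyConstantPred {k : ℕ} (φ : (Fin k → ℕ) → Bool) : Prop :=
  ∃ m0 : ℕ, ∀ m m' : Fin k → ℕ, (∀ i, m0 ≤ m i) → (∀ i, m0 ≤ m' i) → φ m = φ m'

open Pointwise in
theorem linear_ray {k : ℕ} {S : Set (Fin k → ℕ)} (hS : IsLinearSet S) :
    (∃ b p : Fin k → ℕ, (∀ i, 1 ≤ p i) ∧ ∀ n : ℕ, b + n • p ∈ S) ∨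
    ∃ m0 : ℕ, ∀ x ∈ S, ∃ i, x i < m0 := by
  rw [isLinearSet_iff] at hS
  obtain ⟨a, t, rfl⟩ := hS
  by_cases h : ∀ i, ∃ p ∈ t, p i ≠ 0
  · left
    refine ⟨a, ∑ p ∈ t, p, ?_, ?_⟩
    · intro i
      obtain ⟨p, hp, hpi⟩ := h i
      rw [Finset.sum_apply]
      have := Finset.single_le_sum (f := fun p : Fin k → ℕ => p i) (fun _ _ => Nat.zero_le _) hp
      have := this
      show 1 ≤ ∑ c ∈ t, c i
      omega
    · intro n
      refine Set.mem_vadd_set.2 ⟨n • ∑ p ∈ t, p, ?_, rfl⟩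
      exact AddSubmonoid.nsmul_mem _
        (AddSubmonoid.sum_mem _ fun p hp => AddSubmonoid.subset_closure hp) _
  · right
    push Not at h
    obtain ⟨i, hi⟩ := h
    refine ⟨a i + 1, ?_⟩
    intro x hx
    obtain ⟨y, hy, rfl⟩ := Set.mem_vadd_set.1 hx
    refine ⟨i, ?_⟩
    have : y i = 0 := by
      refine AddSubmonoid.closure_induction (motive := fun y _ => y i = 0) ?_ ?_ ?_ hy
      · intro p hp; exact hi p hp
      · rfl
      · intro x y _ _ hx hy; simp [hx, hy]
    simp [this]

theorem semilinear_ray {k : ℕ} {S : Set (Fin k → ℕ)} (hS : IsSemilinearSet S)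
    (h : ∀ m0 : ℕ, ∃ x ∈ S, ∀ i, m0 ≤ x i) :
    ∃ b p : Fin k → ℕ, (∀ i, 1 ≤ p i) ∧ ∀ n : ℕ, b + n • p ∈ S := by
  rw [isSemilinearSet_iff] at hS
  obtain ⟨T, hT, rfl⟩ := hS
  by_contra hcon
  have h1 : ∀ t ∈ T, ∃ m0 : ℕ, ∀ x ∈ t, ∃ i, x i < m0 := by
    intro t ht
    rcases linear_ray (hT t ht) with ⟨b, p, hp, hb⟩ | h2
    · exact absurd ⟨b, p, hp, fun n => Set.mem_sUnion.2 ⟨t, ht, hb n⟩⟩ hcon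
    · exact h2
  choose! f hf using h1
  obtain ⟨x, hx, hxi⟩ := h (T.sup f)
  obtain ⟨t, ht, hxt⟩ := Set.mem_sUnion.1 hx
  obtain ⟨i, hi⟩ := hf t ht x hxt
  have := Finset.le_sup (f := f) ht
  have := hxi i
  omega

theorem semilinear_bridge {k : ℕ} {S : Set (Fin k → ℕ)} (hS : Semilinear S) :
    IsSemilinearSet S := by
  obtain ⟨m, P, hP, rfl⟩ := hS
  refine IsSemilinearSet.iUnion fun j => ?_
  obtain ⟨b, l, per, h⟩ := hP j
  rw [h]
  refine IsLinearSet.isSemilinearSet ⟨b, Set.range per, Set.finite_range _, ?_⟩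
  ext x
  rw [Set.mem_vadd_set]
  simp only [SetLike.mem_coe, AddSubmonoid.mem_closure_range_iff_of_fintype, Set.mem_ofPred_eq]
  constructor
  · rintro ⟨n, rfl⟩
    exact ⟨_, ⟨n, rfl⟩, rfl⟩
  · rintro ⟨_, ⟨n, rfl⟩, rfl⟩
    exact ⟨n, rfl⟩

theorem path_const {k : ℕ} (φ : (Fin k → ℕ) → Bool) (x z : Fin k → ℕ)
    (hstep : ∀ m i, x ≤ m → m + Pi.single i 1 ≤ z → φ m = φ (m + Pi.single i 1)) :
    ∀ (d : ℕ) (m : Fin k → ℕ), x ≤ m → m ≤ z → ∑ i, (z i - m i) = d → φ m = φ z := by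
  intro d
  induction d with
  | zero =>
    intro m _ hz hd
    congr 1
    funext i
    have h1 := (Finset.sum_eq_zero_iff.1 hd) i (Finset.mem_univ i)
    have h2 : m i ≤ z i := hz i
    omega
  | succ d ih =>
    intro m hx hz hd
    obtain ⟨i, hi⟩ : ∃ i, m i < z i := by
      by_contra hcon
      push Not at hcon
      have : ∑ i, (z i - m i) = 0 := Finset.sum_eq_zero fun i _ => by have := hcon i; omega
      omega
    have hle : m + Pi.single i 1 ≤ z := by
      intro j
      by_cases hj : j = i
      · subst hj; simp; omega
      · simp [Pi.single_eq_of_ne hj]; exact hz j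
    rw [hstep m i hx hle]
    refine ih _ (hx.trans (by simp)) hle ?_
    have e : ∑ j, (z j - m j) = ∑ j, (z j - (m + Pi.single i 1 : Fin k → ℕ) j) + ∑ j, (Pi.single i 1 : Fin k → ℕ) j := by
      rw [← Finset.sum_add_distrib]
      refine Finset.sum_congr rfl fun j _ => ?_
      have := hle j
      simp only [Pi.add_apply] at this ⊢
      omega
    rw [Finset.sum_pi_single'] at e
    simp at e hd ⊢
    omega

theorem finite_bound {k : ℕ} {B : Set (Fin k → ℕ)} (hB : B.Finite) :
    ∃ N : ℕ, ∀ m ∈ B, ∀ i, m i < N := by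
  refine ⟨hB.toFinset.sup (fun m => Finset.univ.sup m) + 1, fun m hm i => ?_⟩
  have h1 : m i ≤ Finset.univ.sup m := Finset.le_sup (Finset.mem_univ i)
  have h2 := Finset.le_sup (f := fun m : Fin k → ℕ => Finset.univ.sup m) (hB.mem_toFinset.2 hm)
  omega

/-- If `φ : ℕ^k → {0,1}` is semilinear and not eventually constant, then there is
`α > 0` and an infinite set `D` of `α`-dense vectors such that either (1)
`φ(m) ≠ φ(2m)` for all `m ∈ D`, or (2) for some coordinate `i`,
`φ(m) ≠ φ(m + uᵢ)` and `φ(m) ≠ φ(2(m + uᵢ))` for all `m ∈ D`. -/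
theorem stmt10 {k : ℕ} (φ : (Fin k → ℕ) → Bool)
    (hsemi : Semilinear {m | φ m = true})
    (hnc : ¬ EventuallyConstantPred φ) :
    ∃ α : ℝ, 0 < α ∧ ∃ D : Set (Fin k → ℕ),
      D ⊆ {m | AlphaDense α m} ∧ D.Infinite ∧
      ((∀ m ∈ D, φ m ≠ φ (2 • m)) ∨
        ∃ i : Fin k, ∀ m ∈ D,
          φ m ≠ φ (m + Pi.single i 1) ∧ φ m ≠ φ (2 • (m + Pi.single i 1))) := by
  by_contra hcon
  have hk : 0 < k := by
    rcases Nat.eq_zero_or_pos k with rfl | h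
    · exact absurd ⟨0, fun m m' _ _ => congrArg φ (Subsingleton.elim m m')⟩ hnc
    · exact h
  have hS := semilinear_bridge hsemi
  have hS' := hS.compl
  have hlarge : ∀ m0 : ℕ, (∃ x, φ x = true ∧ ∀ i, m0 ≤ x i) ∧
      (∃ x, φ x = false ∧ ∀ i, m0 ≤ x i) := by
    intro m0
    have h2 : ∃ m m' : Fin k → ℕ, (∀ i, m0 ≤ m i) ∧ (∀ i, m0 ≤ m' i) ∧ φ m ≠ φ m' := by
      by_contra hc
      refine hnc ⟨m0, fun m m' h h' => ?_⟩
      by_contra h3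
      exact hc ⟨m, m', h, h', h3⟩
    obtain ⟨m, m', h, h', hne⟩ := h2
    cases e : φ m <;> cases e' : φ m' <;> rw [e, e'] at hne
    · exact absurd rfl hne
    · exact ⟨⟨m', e', h'⟩, ⟨m, e, h⟩⟩
    · exact ⟨⟨m, e, h⟩, ⟨m', e', h'⟩⟩
    · exact absurd rfl hne
  obtain ⟨b, p, hp, hb⟩ := semilinear_ray hS (fun m0 => (hlarge m0).1)
  obtain ⟨c, q, hq, hc⟩ := semilinear_ray hS' (fun m0 => by
    obtain ⟨x, hx, h⟩ := (hlarge m0).2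
    exact ⟨x, by simp [hx], h⟩)
  obtain ⟨K, hK⟩ := finite_bound (B := {b, p, c, q}) (by simp)
  have hbK := hK b (by simp)
  have hpK := hK p (by simp)
  have hcK := hK c (by simp)
  have hqK := hK q (by simp)
  have hkr : (0 : ℝ) < k := by exact_mod_cast hk
  have hKpos : 0 < K := lt_of_le_of_lt (Nat.zero_le _) (hbK ⟨0, hk⟩)
  have hKr : (0 : ℝ) < K := by exact_mod_cast hKpos
  set α : ℝ := 1 / (4 * K * k) with hα
  have hαpos : 0 < α := by positivity
  have hdense : ∀ (n : ℕ) (m : Fin k → ℕ), (∀ i, n ≤ m i) → (∀ i, m i ≤ 4 * K * n) →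
      AlphaDense α m := by
    intro n m h1 h2 i _
    have hs : ∑ j, (m j : ℝ) ≤ k * (4 * K * n) := by
      calc ∑ j, (m j : ℝ) ≤ ∑ j : Fin k, (4 * K * n : ℝ) :=
            Finset.sum_le_sum fun j _ => by exact_mod_cast h2 j
        _ = _ := by simp
    calc α * ∑ j, (m j : ℝ) ≤ α * (k * (4 * K * n)) := by gcongr
      _ = n := by rw [hα]; field_simp
      _ ≤ m i := by exact_mod_cast h1 i
  have hfin1 : {m | AlphaDense α m ∧ φ m ≠ φ (2 • m)}.Finite := by
    by_contra hinf
    exact hcon ⟨α, hαpos, _, fun m hm => hm.1, hinf, Or.inl fun m hm => hm.2⟩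
  have hfin2 : ∀ i, {m | AlphaDense α m ∧ (φ m ≠ φ (m + Pi.single i 1) ∧
      φ m ≠ φ (2 • (m + Pi.single i 1)))}.Finite := by
    intro i
    by_contra hinf
    exact hcon ⟨α, hαpos, _, fun m hm => hm.1, hinf, Or.inr ⟨i, fun m hm => hm.2⟩⟩
  obtain ⟨N, hN⟩ := finite_bound (hfin1.union (Set.finite_iUnion hfin2))
  set n := N + 1 with hn
  set x := b + n • p with hx
  set y := c + n • q with hy
  have hxn : ∀ i, n ≤ x i := fun i => by
    simp only [hx, Pi.add_apply, Pi.smul_apply, smul_eq_mul]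
    have := Nat.mul_le_mul_left n (hp i)
    omega
  have hyn : ∀ i, n ≤ y i := fun i => by
    simp only [hy, Pi.add_apply, Pi.smul_apply, smul_eq_mul]
    have := Nat.mul_le_mul_left n (hq i)
    omega
  have hKn : K ≤ K * n := Nat.le_mul_of_pos_right _ (by omega)
  have hub : ∀ i, (x + y) i ≤ 4 * K * n := fun i => by
    simp only [hx, hy, Pi.add_apply, Pi.smul_apply, smul_eq_mul]
    have := Nat.mul_le_mul_left n (hpK i).le
    have := Nat.mul_le_mul_left n (hqK i).le
    have := hbK i
    have := hcK i
    have e : 4 * K * n = 4 * (n * K) := by ring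
    have e' : K * n = n * K := mul_comm _ _
    omega
  have hstep : ∀ m i, (∀ j, n ≤ m j) → m + Pi.single i 1 ≤ x + y →
      φ m = φ (m + Pi.single i 1) := by
    intro m i hm hle
    have hm' : ∀ j, n ≤ (m + Pi.single i 1 : Fin k → ℕ) j := fun j => (hm j).trans (by simp)
    have hd' := hdense n _ hm' (fun j => (hle j).trans (hub j))
    have hd := hdense n m hm (fun j => le_trans (by simp) ((hle j).trans (hub j)))
    by_contra hne
    have h2 : φ (m + Pi.single i 1) = φ (2 • (m + Pi.single i 1)) := by
      by_contra h3
      have := hN _ (Or.inl ⟨hd', h3⟩) ⟨0, hk⟩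
      have := hm' ⟨0, hk⟩
      omega
    have := hN m (Or.inr (Set.mem_iUnion.2 ⟨i, hd, hne, h2 ▸ hne⟩)) ⟨0, hk⟩
    have := hm ⟨0, hk⟩
    omega
  have e1 := path_const φ x (x + y) (fun m i h => hstep m i fun j => (hxn j).trans (h j))
    _ x le_rfl (by simp) rfl
  have e2 := path_const φ y (x + y) (fun m i h => hstep m i fun j => (hyn j).trans (h j))
    _ y le_rfl (by simp) rfl
  have t1 : φ x = true := hb n
  have t2 : φ y ≠ true := hc n
  exact t2 (by rw [e2, ← e1, t1])
end
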